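/- For every T > 0 there exists a constant C > 0 such that for all integers n ≥ 1, all t ∈ (0, T] and all x ∈ ℝ³, one has 0 ≤ c²_n(t,x) ≤ C·(1 + n), where c²_n(t,x) = 2·∫₀^t (∫_{ℝ³} K_{t−s}(x,w)·𝒞⁽ⁿ⁾_{t,s}(x,w)² dw) ds. -/

import Mathlib

open MeasureTheory Real

noncomputable section

/-- Mehler heat kernel of the harmonic oscillator `H = -Δ + |x|²` on `ℝ³`. -/
def mehlerK (t : ℝ) (x y : EuclideanSpace ℝ (Fin 3)) : ℝ :=
  (2 * π * Real.sinh (2 * t)) ^ (-(3 : ℝ) / 2) *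
    Real.exp (-‖x - y‖ ^ 2 / (4 * Real.tanh t) - Real.tanh t * ‖x + y‖ ^ 2 / 4)

/-- The regularized covariance `𝒞⁽ⁿ⁾_{t₁,t₂}(y₁,y₂)`, with `ε_n = 2^{-n}`. -/
def covC (n : ℕ) (t₁ t₂ : ℝ) (y₁ y₂ : EuclideanSpace ℝ (Fin 3)) : ℝ :=
  (1 / 2) * ∫ σ in (|t₂ - t₁| + 2 * (2 : ℝ) ^ (-(n : ℝ)))..(t₁ + t₂ + 2 * (2 : ℝ) ^ (-(n : ℝ))),
    mehlerK σ y₁ y₂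

/-- Second renormalization function
`c²_n(t,x) = 2 ∫₀^t ∫ K_{t-s}(x,w) 𝒞⁽ⁿ⁾_{t,s}(x,w)² dw ds`. -/
def c2 (n : ℕ) (t : ℝ) (x : EuclideanSpace ℝ (Fin 3)) : ℝ :=
  2 * ∫ s in (0 : ℝ)..t, ∫ w, mehlerK (t - s) x w * covC n t s x w ^ 2

/-- The Mehler kernel is nonnegative. -/
lemma mehlerK_nonneg {t : ℝ} (ht : 0 ≤ t) (x y : EuclideanSpace ℝ (Fin 3)) :
    0 ≤ mehlerK t x y := by
  have : 0 ≤ sinh (2 * t) := sinh_nonneg_iff.2 (by positivity)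
  unfold mehlerK
  positivity

lemma tanh_pos_of_pos {t : ℝ} (ht : 0 < t) : 0 < tanh t := by
  rw [tanh_eq_sinh_div_cosh]
  exact div_pos (sinh_pos_iff.2 ht) (cosh_pos t)

lemma tanh_le_self_of_pos {t : ℝ} (ht : 0 < t) : tanh t ≤ t := by
  have hmono : MonotoneOn (fun u : ℝ => u * cosh u - sinh u) (Set.Ici 0) := by
    refine monotoneOn_of_hasDerivWithinAt_nonneg (f' := fun u => u * sinh u) (convex_Ici 0)
      (by fun_prop) (fun u _ => ?_) (fun u hu => ?_)
    · have h := ((hasDerivAt_id u).mul (hasDerivAt_cosh u)).sub (hasDerivAt_sinh u)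
      refine HasDerivAt.hasDerivWithinAt (h.congr_deriv ?_)
      simp
    · have hu' : 0 ≤ u := interior_subset hu
      exact mul_nonneg hu' (sinh_nonneg_iff.2 hu')
  have h := hmono Set.self_mem_Ici ht.le ht.le
  simp only [zero_mul, sinh_zero, sub_zero] at h
  rw [tanh_eq_sinh_div_cosh, div_le_iff₀ (cosh_pos t)]
  linarith

/-- The Mehler kernel is dominated by the Euclidean heat kernel. -/
lemma mehlerK_le_heat {t : ℝ} (ht : 0 < t) (x y : EuclideanSpace ℝ (Fin 3)) :
    mehlerK t x y ≤ (4 * π * t) ^ (-(3 : ℝ) / 2) * exp (-(1 / (4 * t)) * ‖x - y‖ ^ 2) := by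
  have hth := tanh_pos_of_pos ht
  have hs : 2 * t ≤ sinh (2 * t) := self_le_sinh_iff.2 (by positivity)
  unfold mehlerK
  gcongr ?_ * exp ?_
  · refine rpow_le_rpow_of_nonpos (by positivity) ?_ (by norm_num)
    nlinarith [pi_pos]
  · have h1 : ‖x - y‖ ^ 2 / (4 * t) ≤ ‖x - y‖ ^ 2 / (4 * tanh t) := by
      gcongr
      exact tanh_le_self_of_pos ht
    have h2 : 0 ≤ tanh t * ‖x + y‖ ^ 2 / 4 := by positivity
    have h3 : -(1 / (4 * t)) * ‖x - y‖ ^ 2 = -(‖x - y‖ ^ 2 / (4 * t)) := by ring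
    rw [h3, neg_div]
    linarith

lemma mehlerK_le_rpow {t : ℝ} (ht : 0 < t) (x y : EuclideanSpace ℝ (Fin 3)) :
    mehlerK t x y ≤ t ^ (-(3 : ℝ) / 2) := by
  refine (mehlerK_le_heat ht x y).trans ?_
  have h1 : exp (-(1 / (4 * t)) * ‖x - y‖ ^ 2) ≤ 1 := by
    rw [exp_le_one_iff]
    have : 0 ≤ 1 / (4 * t) * ‖x - y‖ ^ 2 := by positivity
    linarith
  refine (mul_le_of_le_one_right (by positivity) h1).trans ?_
  refine rpow_le_rpow_of_nonpos ht ?_ (by norm_num)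
  nlinarith [pi_gt_three]

/-- The Euclidean heat kernel has total mass one. -/
lemma integral_heat {t : ℝ} (ht : 0 < t) (x : EuclideanSpace ℝ (Fin 3)) :
    ∫ w, (4 * π * t) ^ (-(3 : ℝ) / 2) * exp (-(1 / (4 * t)) * ‖x - w‖ ^ 2) = 1 := by
  rw [integral_const_mul,
    integral_sub_left_eq_self (fun w => exp (-(1 / (4 * t)) * ‖w‖ ^ 2)) volume x,
    GaussianFourier.integral_rexp_neg_mul_sq_norm (by positivity)]
  have h : π / (1 / (4 * t)) = 4 * π * t := by field_simp
  rw [h, finrank_euclideanSpace_fin, ← rpow_add (by positivity)]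
  norm_num

lemma integrable_heat {t : ℝ} (ht : 0 < t) (x : EuclideanSpace ℝ (Fin 3)) :
    Integrable fun w => (4 * π * t) ^ (-(3 : ℝ) / 2) * exp (-(1 / (4 * t)) * ‖x - w‖ ^ 2) :=
  .of_integral_ne_zero (by rw [integral_heat ht x]; exact one_ne_zero)

/-- The squared regularized covariance is bounded by the inverse of its lower time cutoff. -/
lemma covC_sq_le (n : ℕ) {t s : ℝ} (hs : 0 ≤ s) (hst : s ≤ t) (x y : EuclideanSpace ℝ (Fin 3)) :
    covC n t s x y ^ 2 ≤ (t - s + 2 * (2 : ℝ) ^ (-(n : ℝ)))⁻¹ := by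
  have hε : 0 < (2 : ℝ) ^ (-(n : ℝ)) := by positivity
  unfold covC
  rw [abs_sub_comm, abs_of_nonneg (sub_nonneg.2 hst)]
  set a := t - s + 2 * (2 : ℝ) ^ (-(n : ℝ)) with ha
  set b := t + s + 2 * (2 : ℝ) ^ (-(n : ℝ)) with hb
  have ha0 : 0 < a := by linarith
  have hab : a ≤ b := by linarith
  have h0 : (0 : ℝ) ∉ Set.uIcc a b := by
    rw [Set.uIcc_of_le hab]
    exact fun h => ha0.not_ge h.1
  have hnn : 0 ≤ ∫ σ in a..b, mehlerK σ x y :=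
    intervalIntegral.integral_nonneg hab fun σ hσ => mehlerK_nonneg (ha0.le.trans hσ.1) x y
  have hle : ∫ σ in a..b, mehlerK σ x y ≤ ∫ σ in a..b, σ ^ (-(3 : ℝ) / 2) := by
    have hint := (intervalIntegral.intervalIntegrable_rpow (r := -(3 : ℝ) / 2) (μ := volume)
      (Or.inr h0)).1
    rw [intervalIntegral.integral_of_le hab, intervalIntegral.integral_of_le hab]
    refine integral_mono_of_nonneg ?_ hint ?_
    · filter_upwards [ae_restrict_mem measurableSet_Ioc] with σ hσ
      exact mehlerK_nonneg (ha0.trans hσ.1).le x y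
    · filter_upwards [ae_restrict_mem measurableSet_Ioc] with σ hσ
      exact mehlerK_le_rpow (ha0.trans hσ.1) x y
  rw [integral_rpow (Or.inr ⟨by norm_num, h0⟩)] at hle
  have he : -(3 : ℝ) / 2 + 1 = -(1 / 2) := by norm_num
  rw [he] at hle
  have hb0 : 0 ≤ b ^ (-(1 / 2) : ℝ) := rpow_nonneg (ha0.le.trans hab) _
  have hcov : 1 / 2 * ∫ σ in a..b, mehlerK σ x y ≤ a ^ (-(1 / 2) : ℝ) := by linarith
  calc (1 / 2 * ∫ σ in a..b, mehlerK σ x y) ^ 2 ≤ (a ^ (-(1 / 2) : ℝ)) ^ 2 := by gcongr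
    _ = a⁻¹ := by
      rw [← rpow_natCast, ← rpow_mul ha0.le, ← rpow_neg_one]
      norm_num

lemma integral_mehlerK_mul_covC_sq_le (n : ℕ) {t s : ℝ} (hs : 0 ≤ s) (hst : s < t)
    (x : EuclideanSpace ℝ (Fin 3)) :
    ∫ w, mehlerK (t - s) x w * covC n t s x w ^ 2 ≤
      (t - s + 2 * (2 : ℝ) ^ (-(n : ℝ)))⁻¹ := by
  have hr : 0 < t - s := sub_pos.2 hst
  have h := integral_mono_of_nonneg (μ := volume)
    (f := fun w => mehlerK (t - s) x w * covC n t s x w ^ 2)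
    (.of_forall fun w => mul_nonneg (mehlerK_nonneg hr.le x w) (sq_nonneg _))
    ((integrable_heat hr x).mul_const (t - s + 2 * (2 : ℝ) ^ (-(n : ℝ)))⁻¹)
    (.of_forall fun w => mul_le_mul (mehlerK_le_heat hr x w) (covC_sq_le n hs hst.le x w)
      (sq_nonneg _) (by positivity))
  rwa [integral_mul_const, integral_heat hr x, one_mul] at h

lemma integral_inv_sub_add {t δ : ℝ} (ht : 0 ≤ t) (hδ : 0 < δ) :
    ∫ s in (0 : ℝ)..t, (t - s + δ)⁻¹ = log ((t + δ) / δ) := by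
  have h := intervalIntegral.integral_comp_sub_left (a := 0) (b := t)
    (fun u : ℝ => u⁻¹) (t + δ)
  rw [show t + δ - t = δ by ring, sub_zero, integral_inv_of_pos hδ (by positivity)] at h
  rw [← h]
  congr 1 with s
  ring_nf

lemma log_cutoff_le (n : ℕ) {t T : ℝ} (ht : 0 < t) (htT : t ≤ T) :
    log ((t + 2 * (2 : ℝ) ^ (-(n : ℝ))) / (2 * (2 : ℝ) ^ (-(n : ℝ)))) ≤ (T + 1) * (1 + n) := by
  have hpow : (1 : ℝ) ≤ 2 ^ n := one_le_pow₀ (by norm_num)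
  rw [rpow_neg (by norm_num), rpow_natCast]
  have h1 : (t + 2 * ((2 : ℝ) ^ n)⁻¹) / (2 * ((2 : ℝ) ^ n)⁻¹) ≤ (1 + T) * 2 ^ n := by
    have : (t + 2 * ((2 : ℝ) ^ n)⁻¹) / (2 * ((2 : ℝ) ^ n)⁻¹) = t * 2 ^ n / 2 + 1 := by
      field_simp
    rw [this]
    nlinarith
  have hT : 0 < T := ht.trans_le htT
  refine (log_le_log (by positivity) h1).trans ?_
  rw [log_mul (by positivity) (by positivity), log_pow]
  have h2 := log_le_sub_one_of_pos (show 0 < 1 + T by positivity)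
  have h3 := log_le_sub_one_of_pos (show (0 : ℝ) < 2 by norm_num)
  have hn : (0 : ℝ) ≤ n := n.cast_nonneg
  nlinarith [mul_nonneg hT.le hn]

/-- `0 ≤ c²_n(t,x) ≤ C (1 + n)` for `t ∈ (0,T]`, uniformly in `x`. -/
theorem c2_log_bound (T : ℝ) (hT : 0 < T) :
    ∃ C : ℝ, 0 < C ∧
      ∀ n : ℕ, 1 ≤ n → ∀ t : ℝ, 0 < t → t ≤ T → ∀ x : EuclideanSpace ℝ (Fin 3),
        0 ≤ c2 n t x ∧ c2 n t x ≤ C * (1 + (n : ℝ)) := by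
  refine ⟨2 * (T + 1), by positivity, fun n _ t ht htT x => ?_⟩
  have hε : 0 < 2 * (2 : ℝ) ^ (-(n : ℝ)) := by positivity
  have hnn : ∀ s ∈ Set.Icc 0 t, 0 ≤ ∫ w, mehlerK (t - s) x w * covC n t s x w ^ 2 :=
    fun s hs => integral_nonneg fun w =>
      mul_nonneg (mehlerK_nonneg (sub_nonneg.2 hs.2) x w) (sq_nonneg _)
  refine ⟨mul_nonneg zero_le_two (intervalIntegral.integral_nonneg ht.le hnn), ?_⟩
  have hint : IntervalIntegrable (fun s => (t - s + 2 * (2 : ℝ) ^ (-(n : ℝ)))⁻¹) volume 0 t := by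
    refine ContinuousOn.intervalIntegrable (ContinuousOn.inv₀ (by fun_prop) fun s hs => ?_)
    rw [Set.uIcc_of_le ht.le] at hs
    linarith [hs.2]
  have hle : ∫ s in (0 : ℝ)..t, ∫ w, mehlerK (t - s) x w * covC n t s x w ^ 2 ≤
      ∫ s in (0 : ℝ)..t, (t - s + 2 * (2 : ℝ) ^ (-(n : ℝ)))⁻¹ := by
    rw [intervalIntegral.integral_of_le ht.le, intervalIntegral.integral_of_le ht.le,
      integral_Ioc_eq_integral_Ioo, integral_Ioc_eq_integral_Ioo]
    refine integral_mono_of_nonneg ?_ (hint.1.mono_set Set.Ioo_subset_Ioc_self) ?_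
    · filter_upwards [ae_restrict_mem measurableSet_Ioo] with s hs
      exact hnn s (Set.Ioo_subset_Icc_self hs)
    · filter_upwards [ae_restrict_mem measurableSet_Ioo] with s hs
      exact integral_mehlerK_mul_covC_sq_le n hs.1.le hs.2 x
  rw [integral_inv_sub_add ht.le hε] at hle
  have hlog := log_cutoff_le n ht htT
  unfold c2
  linarith

end
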